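/- Let n ≥ 3 and let (J_cyc, a) be a partial n×n matrix over a field 𝔽 on the cycle pattern such that at least one prescribed entry a_{ij} equals 0. Then tmr(J_cyc,a) = mr(J_cyc,a) ≤ 2 and fmr(J_cyc,a) = mr(J_cyc,a). -/

import Mathlib

open Matrix

variable {F : Type*} [Field F] {m n : Type*} [Fintype m] [Fintype n]

/-- `B` is a completion of the partial matrix `(J, a)`: it agrees with the
prescribed entries on the pattern `J`. -/
def Completes (J : Set (m × n)) (a : m → n → F) (B : Matrix m n F) : Prop :=
  ∀ p ∈ J, B p.1 p.2 = a p.1 p.2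

/-- Minimal rank of the partial matrix `(J, a)`: the minimum of the ranks of
all completions. -/
noncomputable def pmr (J : Set (m × n)) (a : m → n → F) : ℕ :=
  sInf {r : ℕ | ∃ B : Matrix m n F, Completes J a B ∧ B.rank = r}

/-- A pattern `T` is triangular if whenever `(i,j) ∈ T` and `(k,l) ∈ T`,
then `(i,l) ∈ T` or `(k,j) ∈ T`. -/
def Triangular (T : Set (m × n)) : Prop :=
  ∀ p ∈ T, ∀ q ∈ T, (p.1, q.2) ∈ T ∨ (q.1, p.2) ∈ T

/-- Triangular minimal rank: the maximum of `pmr` over triangular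
subpatterns of `J`. -/
noncomputable def ptmr (J : Set (m × n)) (a : m → n → F) : ℕ :=
  sSup {r : ℕ | ∃ T ⊆ J, Triangular T ∧ pmr T a = r}

/-- Pattern of the tensor `(J,a) ⊗ I_b`. -/
def TensorJ (J : Set (m × n)) (b : ℕ) : Set ((m × Fin b) × (n × Fin b)) :=
  {p | (p.1.1, p.2.1) ∈ J}

/-- Entries of the tensor `(J,a) ⊗ I_b`: `a i j` on the diagonal of each
`b × b` block, `0` off the diagonal. -/
def TensorA (a : m → n → F) (b : ℕ) : m × Fin b → n × Fin b → F :=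
  fun ip jq => if ip.2 = jq.2 then a ip.1 jq.1 else 0

/-- `b`-fold minimal rank `mr_b(J,a) = mr((J,a) ⊗ I_b)`. -/
noncomputable def pmrb (J : Set (m × n)) (a : m → n → F) (b : ℕ) : ℕ :=
  pmr (TensorJ J b) (TensorA a b)

/-- Fractional minimal rank: `inf_{b ≥ 1} mr_b(J,a) / b`. -/
noncomputable def pfmr (J : Set (m × n)) (a : m → n → F) : ℝ :=
  ⨅ b : ℕ+, (pmrb J a b : ℝ) / (b : ℝ)

/-- The cycle pattern on `{1,…,n} × {1,…,n}`: positions `(i,i)` for all `i`,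
`(i, i+1)` for `i ≤ n−1`, and `(n, 1)` (encoded via addition mod `n`). -/
def CycleJ (n : ℕ) [NeZero n] : Set (Fin n × Fin n) :=
  {p | p.2 = p.1 ∨ p.2 = p.1 + 1}

set_option linter.unusedSectionVars false

section MinimalRank

theorem exists_completes_rank_eq_pmr (J : Set (m × n)) (a : m → n → F) :
    ∃ B : Matrix m n F, Completes J a B ∧ B.rank = pmr J a :=
  Nat.sInf_mem (s := {r : ℕ | ∃ B : Matrix m n F, Completes J a B ∧ B.rank = r})
    ⟨_, Matrix.of a, fun _ _ => rfl, rfl⟩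

theorem pmr_le_rank {J : Set (m × n)} {a : m → n → F} {B : Matrix m n F}
    (hB : Completes J a B) : pmr J a ≤ B.rank :=
  Nat.sInf_le ⟨B, hB, rfl⟩

theorem le_pmr {J : Set (m × n)} {a : m → n → F} {k : ℕ}
    (h : ∀ B : Matrix m n F, Completes J a B → k ≤ B.rank) : k ≤ pmr J a := by
  obtain ⟨B, hB, hr⟩ := exists_completes_rank_eq_pmr J a
  exact hr ▸ h B hB

theorem pmr_mono {T J : Set (m × n)} (hTJ : T ⊆ J) (a : m → n → F) : pmr T a ≤ pmr J a :=
  le_pmr fun _ hB => pmr_le_rank fun p hp => hB p (hTJ hp)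

theorem pmrb_one_le (J : Set (m × n)) (a : m → n → F) : pmrb J a 1 ≤ pmr J a := by
  refine le_pmr fun B hB => ?_
  refine (pmr_le_rank (B := B.submatrix Prod.fst Prod.fst) fun p hp => ?_).trans
    (B.rank_submatrix_le _ _)
  simpa [TensorA, Subsingleton.elim p.1.2 p.2.2] using hB (p.1.1, p.2.1) hp

theorem ptmr_le_pmr (J : Set (m × n)) (a : m → n → F) : ptmr J a ≤ pmr J a := by
  refine csSup_le ⟨_, ∅, Set.empty_subset _, fun p hp => hp.elim, rfl⟩ ?_
  rintro r ⟨T, hT, -, rfl⟩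
  exact pmr_mono hT a

theorem pmr_le_ptmr {T J : Set (m × n)} (hTJ : T ⊆ J) (hT : Triangular T) (a : m → n → F) :
    pmr T a ≤ ptmr J a := by
  refine le_csSup ⟨pmr J a, ?_⟩ ⟨T, hTJ, hT, rfl⟩
  rintro r ⟨T, hT, -, rfl⟩
  exact pmr_mono hT a

theorem pfmr_le_pmr (J : Set (m × n)) (a : m → n → F) : pfmr J a ≤ pmr J a := by
  refine (ciInf_le ⟨0, ?_⟩ (1 : ℕ+)).trans ?_
  · rintro _ ⟨b, rfl⟩
    positivity
  · simpa using pmrb_one_le J a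

theorem le_pfmr {J : Set (m × n)} {a : m → n → F} {k : ℕ} (h : ∀ b, k * b ≤ pmrb J a b) :
    (k : ℝ) ≤ pfmr J a := by
  refine le_ciInf fun b => ?_
  rw [le_div_iff₀ (by exact_mod_cast b.pos)]
  exact_mod_cast h b

/-- A common value `k` of an upper bound for `pmr` and of lower bounds for the triangular and the
tensor minimal ranks is the value of all three minimal ranks. -/
theorem minimal_ranks_eq_of_bounds {T J : Set (m × n)} {a : m → n → F} {k : ℕ}
    (hle : pmr J a ≤ k) (hTJ : T ⊆ J) (hT : Triangular T) (htri : k ≤ pmr T a)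
    (hten : ∀ b, k * b ≤ pmrb J a b) :
    pmr J a = k ∧ ptmr J a = pmr J a ∧ pfmr J a = pmr J a := by
  have hk : pmr J a = k := hle.antisymm (htri.trans (pmr_mono hTJ a))
  refine ⟨hk, (ptmr_le_pmr J a).antisymm ?_, (pfmr_le_pmr J a).antisymm ?_⟩
  · exact hle.trans (htri.trans (pmr_le_ptmr hTJ hT a))
  · rw [hk]
    exact le_pfmr hten

end MinimalRank

section LowerBounds

theorem card_le_rank_of_scalar_submatrix {ι : Type*} [Fintype ι] [DecidableEq ι]
    (B : Matrix m n F) (r : ι → m) (c : ι → n) {y : F} (hy : y ≠ 0)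
    (h : ∀ s t, B (r s) (c t) = if s = t then y else 0) : Fintype.card ι ≤ B.rank := by
  have hB : B.submatrix r c = Matrix.diagonal fun _ => y := by
    ext s t
    simp [h, Matrix.diagonal_apply]
  rw [← Matrix.rank_of_det_ne_zero (A := B.submatrix r c) (by simp [hB, hy])]
  exact B.rank_submatrix_le r c

theorem two_mul_card_le_rank_of_scalar_submatrices {ι : Type*} [Fintype ι] [DecidableEq ι]
    (B : Matrix m n F) (r r' : ι → m) (c c' : ι → n) {y z : F} (hy : y ≠ 0) (hz : z ≠ 0)
    (h0 : ∀ s t, B (r s) (c t) = 0)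
    (hry : ∀ s t, B (r s) (c' t) = if s = t then y else 0)
    (hcz : ∀ s t, B (r' s) (c t) = if s = t then z else 0) :
    2 * Fintype.card ι ≤ B.rank := by
  have hB : B.submatrix (Sum.elim r r') (Sum.elim c' c) =
      Matrix.fromBlocks (Matrix.diagonal fun _ => y) 0 (B.submatrix r' c')
        (Matrix.diagonal fun _ => z) := by
    ext (s | s) (t | t) <;> simp [h0, hry, hcz, Matrix.diagonal_apply]
  have hr := Matrix.rank_of_det_ne_zero (A := B.submatrix (Sum.elim r r') (Sum.elim c' c))
    (by simp [hB, hy, hz])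
  rw [Fintype.card_sum, ← two_mul] at hr
  exact hr ▸ B.rank_submatrix_le _ _

/-- A nonzero prescribed entry forces all three minimal ranks to be at least one. -/
theorem minimal_ranks_eq_one {J : Set (m × n)} {a : m → n → F} (hle : pmr J a ≤ 1)
    {i : m} {j : n} (hij : (i, j) ∈ J) (ha : a i j ≠ 0) :
    pmr J a = 1 ∧ ptmr J a = pmr J a ∧ pfmr J a = pmr J a := by
  refine minimal_ranks_eq_of_bounds (T := {(i, j)}) hle (by simpa using hij) ?_ ?_ ?_
  · rintro _ rfl _ rfl
    exact Or.inl rfl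
  · refine le_pmr fun B hB => ?_
    have hBij : B i j = a i j := hB (i, j) rfl
    simpa using card_le_rank_of_scalar_submatrix (ι := Unit) B (fun _ => i) (fun _ => j) ha
      (by simp [hBij])
  · refine fun b => le_pmr fun B hB => ?_
    simpa using card_le_rank_of_scalar_submatrix B (fun s : Fin b => (i, s)) (fun s => (j, s)) ha
      fun s t => hB ((i, s), (j, t)) hij

/-- A zero prescribed entry with nonzero prescribed entries in its row and in its column forces all
three minimal ranks to be at least two. -/
theorem minimal_ranks_eq_two {J : Set (m × n)} {a : m → n → F} (hle : pmr J a ≤ 2)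
    {i k : m} {j l : n} (hij : (i, j) ∈ J) (hil : (i, l) ∈ J) (hkj : (k, j) ∈ J)
    (h0 : a i j = 0) (hy : a i l ≠ 0) (hz : a k j ≠ 0) :
    pmr J a = 2 ∧ ptmr J a = pmr J a ∧ pfmr J a = pmr J a := by
  refine minimal_ranks_eq_of_bounds (T := {(i, j), (i, l), (k, j)}) hle ?_ ?_ ?_ ?_
  · rintro _ (rfl | rfl | rfl) <;> assumption
  · rintro _ (rfl | rfl | rfl) _ (rfl | rfl | rfl) <;> simp
  · refine le_pmr fun B hB => ?_
    have hBij : B i j = a i j := hB (i, j) (by simp)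
    have hBil : B i l = a i l := hB (i, l) (by simp)
    have hBkj : B k j = a k j := hB (k, j) (by simp)
    simpa using two_mul_card_le_rank_of_scalar_submatrices (ι := Unit) B (fun _ => i) (fun _ => k)
      (fun _ => j) (fun _ => l) hy hz (by simp [hBij, h0]) (by simp [hBil]) (by simp [hBkj])
  · refine fun b => le_pmr fun B hB => ?_
    have hBij : ∀ s t, B (i, s) (j, t) = 0 := fun s t => by
      simpa [TensorA, h0] using hB ((i, s), (j, t)) hij
    simpa using two_mul_card_le_rank_of_scalar_submatrices B (fun s : Fin b => (i, s))
      (fun s => (k, s)) (fun s => (j, s)) (fun s => (l, s)) hy hz hBij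
      (fun s t => hB ((i, s), (l, t)) hil) (fun s t => hB ((k, s), (j, t)) hkj)

end LowerBounds

section Cycle

/-- Any labelling of the edges of the path obtained from the cycle by deleting the edge `(-1, 0)`
is given by vertex potentials. -/
theorem exists_path_potential {G : Type*} [CommGroup G] (n : ℕ) [NeZero n] (w : Fin n → Fin n → G) :
    ∃ p q : Fin n → G, (∀ i, p i * q i = w i i) ∧
      ∀ i, i + 1 ≠ 0 → p i * q (i + 1) = w i (i + 1) := by
  let f : ℕ → G := fun k =>
    (w (Fin.ofNat n k) (Fin.ofNat n k))⁻¹ * w (Fin.ofNat n k) (Fin.ofNat n k + 1)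
  let q : Fin n → G := fun i => ∏ k ∈ Finset.range i.val, f k
  refine ⟨fun i => w i i * (q i)⁻¹, q, fun i => by simp, fun i hi => ?_⟩
  have hval : (i + 1).val = i.val + 1 := by
    refine Fin.val_add_one_of_lt' (lt_of_le_of_ne i.isLt fun h => hi ?_)
    ext
    simp [Fin.val_add, h]
  have hf : f i = (w i i)⁻¹ * w i (i + 1) := by simp [f]
  have hq : q (i + 1) = q i * f i := by
    simp only [q, hval, Finset.prod_range_succ]
  rw [hq, hf]
  group

theorem mem_cycleJ_iff {n : ℕ} [NeZero n] {i j : Fin n} :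
    (i, j) ∈ CycleJ n ↔ j = i ∨ j = i + 1 :=
  Iff.rfl

/-- A rank one completion when every prescribed zero lies in a row or a column of prescribed
zeros. -/
theorem exists_completes_rank_le_one {n : ℕ} [NeZero n] {a : Fin n → Fin n → F}
    (h0 : a (-1) 0 = 0)
    (h : ∀ i j, (i, j) ∈ CycleJ n → a i j = 0 →
      (∀ l, (i, l) ∈ CycleJ n → a i l = 0) ∨ ∀ k, (k, j) ∈ CycleJ n → a k j = 0) :
    ∃ B : Matrix (Fin n) (Fin n) F, Completes (CycleJ n) a B ∧ B.rank ≤ 1 := by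
  classical
  obtain ⟨p, q, hd, hu⟩ := exists_path_potential n fun i j : Fin n =>
    if hij : a i j = 0 then (1 : Fˣ) else Units.mk0 (a i j) hij
  have hpq : ∀ i j, (i, j) ∈ CycleJ n → a i j ≠ 0 → (p i * q j : F) = a i j := by
    rintro i j hij ha
    rw [← Units.val_mul]
    rcases mem_cycleJ_iff.1 hij with rfl | rfl
    · simp [hd, ha]
    · rw [hu]
      · simp [ha]
      · intro hi
        obtain rfl := eq_neg_of_add_eq_zero_left hi
        exact ha (by simpa using h0)
  refine ⟨Matrix.vecMulVec
    (fun i => if ∀ l, (i, l) ∈ CycleJ n → a i l = 0 then 0 else (p i : F))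
    (fun j => if ∀ k, (k, j) ∈ CycleJ n → a k j = 0 then 0 else (q j : F)), ?_,
    Matrix.rank_vecMulVec_le _ _⟩
  rintro ⟨i, j⟩ hij
  by_cases ha : a i j = 0
  · rcases h i j hij ha with hr | hc
    · simp only [Matrix.vecMulVec_apply, if_pos hr, zero_mul, ha]
    · simp only [Matrix.vecMulVec_apply, if_pos hc, mul_zero, ha]
  · have hr : ¬ ∀ l, (i, l) ∈ CycleJ n → a i l = 0 := fun hr => ha (hr j hij)
    have hc : ¬ ∀ k, (k, j) ∈ CycleJ n → a k j = 0 := fun hc => ha (hc i hij)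
    simp only [Matrix.vecMulVec_apply, if_neg hr, if_neg hc, hpq i j hij ha]

theorem rank_vecMulVec_add_vecMulVec_le (x x' : m → F) (y y' : n → F) :
    (Matrix.vecMulVec x y + Matrix.vecMulVec x' y').rank ≤ 2 := by
  have h : Matrix.vecMulVec x y + Matrix.vecMulVec x' y' =
      Matrix.of (fun i => ![x i, x' i]) * (Matrix.of fun j => ![y j, y' j])ᵀ := by
    ext i j
    simp [Matrix.mul_apply, Matrix.vecMulVec_apply]
  rw [h]
  exact (Matrix.rank_mul_le_left _ _).trans (Matrix.rank_le_card_width _)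

theorem exists_completes_rank_le_two {n : ℕ} [NeZero n] (hn : 3 ≤ n) {a : Fin n → Fin n → F}
    (h0 : a (-1) 0 = 0) :
    ∃ B : Matrix (Fin n) (Fin n) F, Completes (CycleJ n) a B ∧ B.rank ≤ 2 := by
  obtain ⟨p, q, hd, hu⟩ : ∃ p q : Fin n → F, (∀ i, p i + q i = a i i) ∧
      ∀ i, i + 1 ≠ 0 → p i + q (i + 1) = a i (i + 1) :=
    exists_path_potential (G := Multiplicative F) n a
  have h1 : (1 : Fin n) ≠ 0 := by
    intro h
    have := congrArg Fin.val h
    simp [Nat.mod_eq_of_lt (show 1 < n by omega)] at this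
  have h2 : (1 : Fin n) + 1 ≠ 0 := by
    intro h
    have := congrArg Fin.val h
    simp [Fin.val_add, Nat.mod_eq_of_lt (show 1 < n by omega),
      Nat.mod_eq_of_lt (show 2 < n by omega)] at this
  by_cases hδ : a 0 0 = 0
  · refine ⟨_, ?_, rank_vecMulVec_add_vecMulVec_le p (fun _ => 1)
      (fun j => if j = 0 then 0 else 1) (fun j => if j = 0 then 0 else q j)⟩
    rintro ⟨i, j⟩ (hj | hj) <;> dsimp only at hj <;> subst hj
    · by_cases hi : j = 0
      · subst hi
        simp [Matrix.vecMulVec_apply, hδ]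
      · simp [Matrix.vecMulVec_apply, hi, hd]
    · by_cases hi : i + 1 = 0
      · obtain rfl := eq_neg_of_add_eq_zero_left hi
        simp [Matrix.vecMulVec_apply, h0]
      · simp [Matrix.vecMulVec_apply, hi, hu]
  · obtain ⟨k, hk⟩ : ∃ k : Fin n, k + 1 = -1 := ⟨-1 - 1, sub_add_cancel _ _⟩
    have hneg : (-1 : Fin n) ≠ 0 := neg_ne_zero.2 h1
    have h1neg : (1 : Fin n) ≠ -1 := fun h => h2 (add_eq_zero_iff_eq_neg.2 h)
    have hk0 : k ≠ 0 := by
      rintro rfl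
      exact h1neg (by simpa using hk)
    have hkneg : k ≠ -1 := by
      rintro rfl
      exact hneg (by simpa using hk.symm)
    refine ⟨_, ?_, rank_vecMulVec_add_vecMulVec_le
      (fun i => if i = -1 then 0 else if i = 0 then a 0 0 else 1)
      (fun i => if i = -1 then 1 else if i = 0 then a 0 1 - a 0 0 * q 1 else p i)
      (fun j => if j = 0 then 1 else if j = -1 then a k (-1) - p k * a (-1) (-1) else q j)
      (fun j => if j = 0 then 0 else if j = -1 then a (-1) (-1) else 1)⟩
    rintro ⟨i, j⟩ (hj | hj) <;> dsimp only at hj <;> subst hj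
    · by_cases hj0 : j = 0
      · subst hj0
        simp [Matrix.vecMulVec_apply, hneg.symm]
      by_cases hjn : j = -1
      · subst hjn
        simp [Matrix.vecMulVec_apply, h1]
      simp [Matrix.vecMulVec_apply, hj0, hjn, ← hd, add_comm]
    · by_cases hin : i = -1
      · subst hin
        simp [Matrix.vecMulVec_apply, h0]
      by_cases hi0 : i = 0
      · subst hi0
        simp [Matrix.vecMulVec_apply, hneg.symm, h1, h1neg]
      have hi : i + 1 ≠ 0 := fun h => hin (eq_neg_of_add_eq_zero_left h)
      by_cases hik : i = k
      · subst hik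
        simp [Matrix.vecMulVec_apply, hk, hk0, hkneg, h1]
      have hin' : i + 1 ≠ -1 := fun h => hik (add_right_cancel (h.trans hk.symm))
      simp [Matrix.vecMulVec_apply, hi, hi0, hin, hin', ← hu i hi, add_comm]

/-- The automorphisms of the cycle act transitively on its edges. -/
theorem exists_equiv_cycleJ {n : ℕ} [NeZero n] {r c : Fin n} (h : (r, c) ∈ CycleJ n) :
    ∃ ρ γ : Fin n ≃ Fin n, ρ (-1) = r ∧ γ 0 = c ∧
      ∀ i j, (ρ i, γ j) ∈ CycleJ n ↔ (i, j) ∈ CycleJ n := by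
  rcases mem_cycleJ_iff.1 h with rfl | rfl
  · refine ⟨Equiv.subLeft (c - 1), Equiv.subLeft c, by simp, by simp, fun i j => ?_⟩
    simp only [mem_cycleJ_iff, Equiv.subLeft_apply]
    rw [or_comm]
    refine or_congr ?_ ?_
    · rw [sub_right_comm, sub_add_cancel, sub_right_inj]
    · rw [sub_sub, sub_right_inj, add_comm]
  · refine ⟨Equiv.addRight (r + 1), Equiv.addRight (r + 1), by simp, by simp, fun i j => ?_⟩
    simp only [mem_cycleJ_iff, Equiv.coe_addRight, add_left_inj, add_right_comm i (r + 1) 1]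

/-- Relabelling rows and columns by bijections that preserve the pattern preserves upper bounds for
the minimal rank. -/
theorem pmr_le_of_equiv {J : Set (m × n)} {a : m → n → F} (ρ : m ≃ m) (γ : n ≃ n)
    (h : ∀ i j, (ρ i, γ j) ∈ J ↔ (i, j) ∈ J) {k : ℕ}
    (hB : ∃ B : Matrix m n F, Completes J (fun i j => a (ρ i) (γ j)) B ∧ B.rank ≤ k) :
    pmr J a ≤ k := by
  obtain ⟨B, hB, hr⟩ := hB
  refine (pmr_le_rank (B := B.submatrix ρ.symm γ.symm) fun p hp => ?_).trans
    ((B.rank_submatrix_le _ _).trans hr)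
  simpa using hB (ρ.symm p.1, γ.symm p.2) ((h _ _).1 (by simpa using hp))

theorem pmr_cycleJ_le_two {n : ℕ} [NeZero n] (hn : 3 ≤ n) {a : Fin n → Fin n → F} {r c : Fin n}
    (hrc : (r, c) ∈ CycleJ n) (h0 : a r c = 0) : pmr (CycleJ n) a ≤ 2 := by
  obtain ⟨ρ, γ, rfl, rfl, h⟩ := exists_equiv_cycleJ hrc
  exact pmr_le_of_equiv ρ γ h (exists_completes_rank_le_two hn h0)

theorem pmr_cycleJ_le_one {n : ℕ} [NeZero n] {a : Fin n → Fin n → F} {r c : Fin n}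
    (hrc : (r, c) ∈ CycleJ n) (h0 : a r c = 0)
    (hz : ∀ i j, (i, j) ∈ CycleJ n → a i j = 0 →
      (∀ l, (i, l) ∈ CycleJ n → a i l = 0) ∨ ∀ k, (k, j) ∈ CycleJ n → a k j = 0) :
    pmr (CycleJ n) a ≤ 1 := by
  obtain ⟨ρ, γ, rfl, rfl, h⟩ := exists_equiv_cycleJ hrc
  refine pmr_le_of_equiv ρ γ h (exists_completes_rank_le_one h0 fun i j hij ha => ?_)
  exact (hz _ _ ((h i j).2 hij) ha).imp (fun hr l hl => hr _ ((h i l).2 hl))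
    fun hc k hk => hc _ ((h k j).2 hk)

end Cycle

/-- For the `n × n` cycle pattern (`n ≥ 3`) with at least one
prescribed entry equal to `0`, one has `tmr = mr ≤ 2` and `fmr = mr`. -/
theorem stmt19 {F : Type*} [Field F] (n : ℕ) [NeZero n] (hn : 3 ≤ n)
    (a : Fin n → Fin n → F)
    (hz : ∃ p ∈ CycleJ n, a p.1 p.2 = 0) :
    ptmr (CycleJ n) a = pmr (CycleJ n) a ∧ pmr (CycleJ n) a ≤ 2 ∧
      pfmr (CycleJ n) a = (pmr (CycleJ n) a : ℝ) := by
  obtain ⟨⟨r, c⟩, hrc, h0⟩ := hz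
  have hle : pmr (CycleJ n) a ≤ 2 := pmr_cycleJ_le_two hn hrc h0
  by_cases hz : ∀ i j, (i, j) ∈ CycleJ n → a i j = 0 →
      (∀ l, (i, l) ∈ CycleJ n → a i l = 0) ∨ ∀ k, (k, j) ∈ CycleJ n → a k j = 0
  · by_cases hall : ∀ i j, (i, j) ∈ CycleJ n → a i j = 0
    · have hle_zero : pmr (CycleJ n) a ≤ 0 := by
        refine (pmr_le_rank (B := 0) fun p hp => ?_).trans_eq Matrix.rank_zero
        exact (hall p.1 p.2 hp).symm
      obtain ⟨-, ht, hf⟩ := minimal_ranks_eq_of_bounds (T := ∅) hle_zero (Set.empty_subset _)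
        (fun p hp => hp.elim) (Nat.zero_le _) (by simp)
      exact ⟨ht, hle, hf⟩
    · push Not at hall
      obtain ⟨i, j, hij, ha⟩ := hall
      obtain ⟨-, ht, hf⟩ := minimal_ranks_eq_one (pmr_cycleJ_le_one hrc h0 hz) hij ha
      exact ⟨ht, hle, hf⟩
  · push Not at hz
    obtain ⟨i, j, hij, ha, ⟨l, hil, hl⟩, k, hkj, hk⟩ := hz
    obtain ⟨-, ht, hf⟩ := minimal_ranks_eq_two hle hij hil hkj ha hl hk
    exact ⟨ht, hle, hf⟩
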